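/- Let ω be a resonant direction in ℝ^d, and let m, n ∈ ℤ. Then ω_n^⊥ ∩ ω_m^⊥ ≠ ∅ if and only if m ≡ n (mod |p_ω|²), in which case ω_n^⊥ = ω_m^⊥. Moreover, the set ω^⊥ := ⋃_{n∈ℤ} ω_n^⊥, consisting of the orthogonal projections onto I_ω of the vectors in ℤ^d, is a subgroup of (ℝ^d, +). -/

import Mathlib

/-!
Setting (F. Macià, "High-frequency propagation for the Schrödinger equation on
the torus").

The flat torus `𝕋^d = ℝ^d/(2πℤ)^d` is modelled as `Fin d → AddCircle (2π)`; an
element `u ∈ L²(𝕋^d)` is represented by its sequence of Fourier coefficients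
`û : ℤ^d → ℂ` (with respect to the orthonormal basis `ψ_k = (2π)^{-d/2} e^{ik·x}`),
and operators on `L²(γ_ω)` by their kernels (matrices) in the orthonormal basis
`φ_m^ω(s) = e^{ims/|p_ω|}/√(2π|p_ω|)`, `m ∈ ℤ`.
-/

noncomputable section

open MeasureTheory Filter
open scoped BigOperators ComplexConjugate Topology ENNReal

namespace TorusSchrodinger

instance fact_two_pi_pos : Fact (0 < 2 * Real.pi) := ⟨by positivity⟩

/-- The lattice `ℤ^d` of Fourier frequencies. -/
abbrev Zd (d : ℕ) := Fin d → ℤ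
/-- Euclidean space `ℝ^d` (the fibre of `T^*𝕋^d`). -/
abbrev Rd (d : ℕ) := Fin d → ℝ
/-- The standard flat torus `𝕋^d = ℝ^d/(2πℤ)^d`. -/
abbrev Td (d : ℕ) := Fin d → AddCircle (2 * Real.pi)
/-- The phase space `T^*𝕋^d ≅ 𝕋^d × ℝ^d`. -/
abbrev Phase (d : ℕ) := Td d × Rd d

variable {d : ℕ}

/-- Inclusion of the lattice `ℤ^d` into `ℝ^d`. -/
def toRd (k : Zd d) : Rd d := fun i => (k i : ℝ)

/-- The canonical projection `ℝ^d → 𝕋^d`. -/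
def torusProj (x : Rd d) : Td d := fun i => (x i : AddCircle (2 * Real.pi))

/-- The character `e^{i k·x}` on the torus `𝕋^d`. -/
def char (k : Zd d) (x : Td d) : ℂ := ∏ i, fourier (k i) (x i)

/-- Euclidean inner product of two lattice vectors. -/
def dotZ (k l : Zd d) : ℤ := ∑ i, k i * l i

/-- Euclidean inner product of a lattice vector with a vector of `ℝ^d`. -/
def dotR (k : Zd d) (ξ : Rd d) : ℝ := ∑ i, (k i : ℝ) * ξ i

/-- The set `Ω` of resonant frequencies in `ℝ^d`. -/
def Omega (d : ℕ) : Set (Rd d) := {ξ | ∃ k : Zd d, k ≠ 0 ∧ dotR k ξ = 0}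

/-- A resonant direction `ω ∈ 𝕎`, encoded by its primitive lattice vector `p_ω`:
the nonzero components of `p_ω` are coprime and its first nonzero component is
positive. -/
structure ResonantDir (d : ℕ) where
  p : Zd d
  ne : p ≠ 0
  gcd_one : Finset.univ.gcd (fun i => (p i).natAbs) = 1
  first_pos : ∀ i, (∀ j, j < i → p j = 0) → 0 ≤ p i

/-- `|p_ω|²`, as an integer. -/
def ResonantDir.M (ω : ResonantDir d) : ℤ := dotZ ω.p ω.p

/-- Orthogonal projection of a lattice point onto the hyperplane `I_ω`. -/
def projPerp (ω : ResonantDir d) (k : Zd d) : Rd d :=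
  toRd k - (((dotZ k ω.p : ℝ) / (ω.M : ℝ)) • toRd ω.p)

/-- The set `ω_n^⊥ ⊆ I_ω`: those `r` in the hyperplane `I_ω` with
`(n/|p_ω|)ν_ω + r ∈ ℤ^d` (note `(n/|p_ω|)ν_ω = (n/|p_ω|²) p_ω`). -/
def perpSet (ω : ResonantDir d) (n : ℤ) : Set (Rd d) :=
  {r | dotR ω.p r = 0 ∧ ∃ k : Zd d, toRd k = ((n : ℝ) / (ω.M : ℝ)) • toRd ω.p + r}

/-! Kernels: operators on `L²(γ_ω)` are represented by their matrix in the
orthonormal basis `(φ_m^ω)_{m ∈ ℤ}`. -/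

/-- Kernels of Hermitian operators. -/
def KerHermitian (K : ℤ → ℤ → ℂ) : Prop := ∀ m n, K n m = conj (K m n)

/-- Positive (semidefinite) kernels: the quadratic form is nonnegative on all
finitely supported vectors. -/
def KerPos (K : ℤ → ℤ → ℂ) : Prop :=
  ∀ v : ℤ →₀ ℂ, 0 ≤ (∑ m ∈ v.support, ∑ n ∈ v.support, conj (v m) * K m n * v n).re

/-- Hilbert–Schmidt kernels. -/
def IsHSKer (K : ℤ → ℤ → ℂ) : Prop := Summable fun q : ℤ × ℤ => ‖K q.1 q.2‖ ^ 2

/-- Trace class kernels: products of two Hilbert–Schmidt kernels. -/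
def IsTraceClassKer (K : ℤ → ℤ → ℂ) : Prop :=
  ∃ A B : ℤ → ℤ → ℂ, IsHSKer A ∧ IsHSKer B ∧ ∀ m n, K m n = ∑' j : ℤ, A m j * B j n

/-- Kernels of operators of operator norm at most 1. -/
def KerContraction (C : ℤ → ℤ → ℂ) : Prop :=
  ∀ v : ℤ →₀ ℂ, ∑' m : ℤ, ‖∑ n ∈ v.support, C m n * v n‖ ^ 2 ≤ ∑ n ∈ v.support, ‖v n‖ ^ 2

/-- The trace norm `tr|K|` of a kernel, via duality with contractions. -/
def traceNorm (K : ℤ → ℤ → ℂ) : ℝ :=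
  ⨆ C : {C : ℤ → ℤ → ℂ // KerContraction C}, ‖∑' q : ℤ × ℤ, K q.1 q.2 * C.1 q.2 q.1‖

/-- Truncation of a kernel to the square `[-N,N]²`. -/
def kerTrunc (N : ℕ) (C : ℤ → ℤ → ℂ) : ℤ → ℤ → ℂ := fun m n =>
  if m.natAbs ≤ N ∧ n.natAbs ≤ N then C m n else 0

/-- The operator norm of a kernel. -/
def kerOpNorm (C : ℤ → ℤ → ℂ) : ℝ :=
  ⨆ v : {v : ℤ →₀ ℂ // ∑ n ∈ v.support, ‖v n‖ ^ 2 ≤ 1},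
    Real.sqrt (∑' m : ℤ, ‖∑ n ∈ v.1.support, C m n * v.1 n‖ ^ 2)

/-- Kernels of compact operators: operator-norm limits of their finite truncations. -/
def KerCompact (C : ℤ → ℤ → ℂ) : Prop :=
  Tendsto (fun N : ℕ => kerOpNorm fun m n => C m n - kerTrunc N C m n) atTop (𝓝 0)

/-! Wigner distributions. -/

/-- Fourier coefficients of the solution at time `t` of the Schrödinger equation
`i∂_t u + (1/2)Δu = 0` on `𝕋^d` in terms of those of the initial datum. -/
def schrodinger (t : ℝ) (u : Zd d → ℂ) : Zd d → ℂ := fun k =>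
  Complex.exp (-Complex.I * (t : ℂ) * (((∑ i, ((k i : ℝ)) ^ 2 : ℝ)) : ℂ) / 2) * u k

/-- The pairing `⟨w_u^h, a⟩` of the Wigner distribution at scale `h` of (the
function with Fourier coefficients) `u` with a symbol `a` on `T^*𝕋^d`. -/
def wignerPair (u : Zd d → ℂ) (h : ℝ) (a : Phase d → ℂ) : ℂ :=
  (((2 * Real.pi) ^ d : ℝ) : ℂ)⁻¹ *
    ∑' q : Zd d × Zd d,
      u q.1 * conj (u q.2) *
        ∫ x : Td d, a (x, (h / 2) • (toRd q.1 + toRd q.2)) * char (q.1 - q.2) x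

/-- Test symbols `a ∈ C_c^∞(T^*𝕋^d)`. -/
def IsSymbol (a : Phase d → ℂ) : Prop :=
  Continuous a ∧ HasCompactSupport a ∧
    ContDiff ℝ (⊤ : ℕ∞) fun q : Rd d × Rd d => a (torusProj q.1, q.2)

/-- A sequence of data `(u_h)` in `L²(𝕋^d)` (given by their Fourier coefficients),
bounded in `L²`, with scales `h → 0⁺`. -/
structure WignerData (d : ℕ) where
  h : ℕ → ℝ
  u : ℕ → Zd d → ℂ
  h_pos : ∀ n, 0 < h n
  h_lim : Tendsto h atTop (𝓝 0)
  bounded : ∃ C : ℝ, ∀ n, ∑' k, ‖u n k‖ ^ 2 ≤ C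

/-- Extraction of a subsequence. -/
def WignerData.sub (D : WignerData d) (σ : ℕ → ℕ) (hσ : StrictMono σ) : WignerData d where
  h := D.h ∘ σ
  u := D.u ∘ σ
  h_pos n := D.h_pos (σ n)
  h_lim := D.h_lim.comp hσ.tendsto_atTop
  bounded := D.bounded.imp fun _C hC n => hC (σ n)

/-- The `h`-oscillation property:
`limsup_{h→0⁺} ∑_{|k| > R/h} |û_h(k)|² → 0` as `R → ∞`. -/
def HOsc (D : WignerData d) : Prop :=
  Tendsto (fun R : ℝ =>
      limsup (fun n =>
        ∑' k : {k : Zd d // R ^ 2 < (∑ i, ((k i : ℝ)) ^ 2) * (D.h n) ^ 2}, ‖D.u n k.1‖ ^ 2)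
        atTop)
    atTop (𝓝 0)

/-- `μ0` is the semiclassical (Wigner) measure of the sequence `(u_h)`:
`w_{u_h}^h(0,·) ⇀ μ0`. -/
def IsSemiclassical (D : WignerData d) (μ0 : Measure (Phase d)) : Prop :=
  ∀ a : Phase d → ℂ, IsSymbol a →
    Tendsto (fun n => wignerPair (D.u n) (D.h n) a) atTop (𝓝 (∫ q, a q ∂μ0))

/-- `μ` is a time-averaged Wigner limit of the Schrödinger evolution of `(u_h)`. -/
def IsTimeAvgLimit (D : WignerData d) (μ : ℝ → Measure (Phase d)) : Prop :=
  ∀ a : Phase d → ℂ, IsSymbol a → ∀ φ : ℝ → ℂ, Integrable φ →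
    Tendsto (fun n => ∫ t : ℝ, φ t * wignerPair (schrodinger t (D.u n)) (D.h n) a) atTop
      (𝓝 (∫ t : ℝ, φ t * ∫ q, a q ∂(μ t)))

/-! The resonant Wigner distribution and resonant Wigner measures. -/

/-- The pairing `tr ∫ b(ξ) R_u^h(ω, dξ)` of the resonant Wigner distribution of `u`
at scale `h` in the resonant direction `ω` with an operator-valued test function
`b` (given by its kernel in the basis `(φ_m^ω)`).  The parametrisation
`k = (m/|p_ω|)ν_ω + r`, `j = (n/|p_ω|)ν_ω + r` (so `m = k·p_ω`, `n = j·p_ω`,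
`r = projPerp ω k`) of pairs of frequencies with `k - j ∈ ℤ p_ω` is used. -/
def resPair (u : Zd d → ℂ) (h : ℝ) (ω : ResonantDir d) (b : Rd d → ℤ → ℤ → ℂ) : ℂ :=
  ∑' q : {q : Zd d × Zd d // ∃ l : ℤ, q.1 - q.2 = l • ω.p},
    u q.1.1 * conj (u q.1.2) * b (h • projPerp ω q.1.1) (dotZ q.1.2 ω.p) (dotZ q.1.1 ω.p)

/-- A positive finite measure on `ℝ^d` with values in the trace-class operators on
`L²(γ_ω)`, represented (via the Radon–Nikodym theorem for operator-valued
measures) by its scalar trace measure `trMeas` and a measurable field `dens` of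
positive Hermitian density matrices of unit trace (in the basis `(φ_m^ω)`). -/
structure OpMeasure (d : ℕ) where
  trMeas : Measure (Rd d)
  finite : IsFiniteMeasure trMeas
  dens : Rd d → ℤ → ℤ → ℂ
  meas : ∀ m n, Measurable fun ξ => dens ξ m n
  herm : ∀ ξ m n, dens ξ n m = conj (dens ξ m n)
  pos : ∀ ξ, KerPos (dens ξ)
  normalized : ∀ ξ, HasSum (fun m : ℤ => dens ξ m m) 1

/-- The pairing `tr ∫ b(ξ) μ(dξ)` of an operator-valued measure with an
operator-valued test function. -/
def OpMeasure.trPair (M : OpMeasure d) (b : Rd d → ℤ → ℤ → ℂ) : ℂ :=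
  ∫ ξ, (∑' q : ℤ × ℤ, b ξ q.2 q.1 * M.dens ξ q.1 q.2) ∂M.trMeas

/-- Test sections `b ∈ C_c(I_ω; K(L²(γ_ω)))`: continuous, compactly supported,
compact-operator-valued. -/
def IsOpTestField (b : Rd d → ℤ → ℤ → ℂ) : Prop :=
  Continuous b ∧ HasCompactSupport b ∧ ∀ ξ : Rd d, KerCompact (b ξ)

/-- `μR` is a resonant Wigner measure of the sequence `(u_h)`: for every resonant
direction `ω` it is a positive trace-class-operator-valued measure concentrated
on `I_ω` whose matrix entries `(m,n)` vanish unless `m ≡ n (mod |p_ω|²)`, and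
`tr ∫ b dR_{u_h}^h(ω,·) → tr ∫ b dμR(ω,·)` for all test sections `b`. -/
def IsResonantWignerMeasure (D : WignerData d) (μR : ResonantDir d → OpMeasure d) : Prop :=
  ∀ ω : ResonantDir d,
    (μR ω).trMeas {ξ | dotR ω.p ξ ≠ 0} = 0 ∧
    (∀ (ξ : Rd d) (m n : ℤ), ¬ (ω.M ∣ (m - n)) → (μR ω).dens ξ m n = 0) ∧
    ∀ b : Rd d → ℤ → ℤ → ℂ, IsOpTestField b →
      Tendsto (fun n => resPair (D.u n) (D.h n) ω b) atTop (𝓝 ((μR ω).trPair b))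

/-- The density matrix of `μ_R^t(ω,·) = e^{it∂_ω²/2} μ_R⁰(ω,·) e^{-it∂_ω²/2}`, the
solution of the density-matrix Schrödinger equation
`i∂_t μ_R^t = [-(1/2)∂_ω², μ_R^t]` on `γ_ω` with initial datum `μ_R⁰`. -/
def densT (M : OpMeasure d) (ω : ResonantDir d) (t : ℝ) (ξ : Rd d) (m n : ℤ) : ℂ :=
  Complex.exp (-Complex.I * (t : ℂ) * ((((m ^ 2 - n ^ 2 : ℤ) : ℝ) / (2 * (ω.M : ℝ)) : ℝ) : ℂ)) *
    M.dens ξ m n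

/-- The geodesic flow `φ_s(x,ξ) = (x + sξ, ξ)` on `T^*𝕋^d`. -/
def geoFlow (s : ℝ) (q : Phase d) : Phase d := (q.1 + torusProj (s • q.2), q.2)

/-- `g` is (a density of) the signed measure
`ρ_ω^t = E_ω(ρ̃_ω^t(·,ξ) − (2π|p_ω|)⁻¹ (tr μ_R^t(ω,ξ)) ds)` on `𝕋^d × I_ω`, where
`ρ̃_ω^t` is the trace density of `μ_R^t(ω,·)` and `E_ω` the extension operator:
`g` is characterised by its Fourier coefficients in `x`, which are supported on
the frequencies `l p_ω`, `l ≠ 0`, and are given there by the corresponding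
traces `∑_{m-n=l|p_ω|²} μ_R^t(ω,·)(m,n)` of the propagated measure. -/
def IsRhoDensity (M : OpMeasure d) (ω : ResonantDir d) (t : ℝ) (g : Phase d → ℝ) : Prop :=
  Integrable g ((volume : Measure (Td d)).prod M.trMeas) ∧
  (∀ l : ℤ, l ≠ 0 → ∀ φ : Rd d → ℂ, Continuous φ → HasCompactSupport φ →
    ∫ q : Phase d, char (l • ω.p) q.1 * φ q.2 * ((g q : ℝ) : ℂ)
        ∂((volume : Measure (Td d)).prod M.trMeas)
      = ∫ ξ : Rd d, φ ξ * ∑' n : ℤ, densT M ω t ξ (n - l * ω.M) n ∂M.trMeas) ∧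
  (∀ k : Zd d, (¬ ∃ l : ℤ, l ≠ 0 ∧ k = l • ω.p) → ∀ φ : Rd d → ℂ, Continuous φ →
    HasCompactSupport φ →
    ∫ q : Phase d, char k q.1 * φ q.2 * ((g q : ℝ) : ℂ)
        ∂((volume : Measure (Td d)).prod M.trMeas) = 0)

/-- The signed measure `ρ_ω^t` on `T^*𝕋^d` associated to a density `g` (with
respect to `dx ⊗ tr μ_R(ω,·)`). -/
def rhoMeas (M : OpMeasure d) (g : Phase d → ℝ) : SignedMeasure (Phase d) :=
  ((volume : Measure (Td d)).prod M.trMeas).withDensityᵥ g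

/-! Symbols, `k_{a,φ}`, `K_b`, position densities, wave packets. -/

/-- The `k`-th Fourier coefficient in `x` of a symbol `a(x,ξ)` on `T^*𝕋^d`:
`a_k(ξ) = ∫_{𝕋^d} a(x,ξ) conj(ψ_k(x)) dx`. -/
def symbCoeff (a : Phase d → ℂ) (k : Zd d) (ξ : Rd d) : ℂ :=
  ((Real.sqrt ((2 * Real.pi) ^ d) : ℝ) : ℂ)⁻¹ * ∫ x : Td d, a (x, ξ) * conj (char k x)

/-- The Fourier transform `φ̂(s) = ∫ φ(t) e^{-its} dt`. -/
def phiHat (φ : ℝ → ℂ) (s : ℝ) : ℂ :=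
  ∫ t : ℝ, φ t * Complex.exp (-Complex.I * (t : ℂ) * (s : ℂ))

/-- The kernel (in the basis `(φ_m^ω)`) of the operator `k_{a,φ}(ω,ξ)` on
`L²(γ_ω)`. -/
def kerKaphi (a : Phase d → ℂ) (φ : ℝ → ℂ) (ω : ResonantDir d) (ξ : Rd d) (m n : ℤ) : ℂ :=
  if m ≠ n ∧ ω.M ∣ (m - n) then
    ((Real.sqrt ((2 * Real.pi) ^ d) : ℝ) : ℂ)⁻¹ *
      phiHat φ (((n ^ 2 - m ^ 2 : ℤ) : ℝ) / (2 * (ω.M : ℝ))) *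
      symbCoeff a (((m - n) / ω.M) • ω.p) ξ
  else 0

/-- The kernel (in the basis `(φ_m^ω)`) of the operator
`K_b = ∫_{I_ω} b(ξ) R_u^h(ω,dξ)` on `L²(γ_ω)`: for `m ≡ n (mod |p_ω|²)`,
`k_b(m,n) = ∑_{r ∈ ω_c^⊥} b(hr) û((m/|p_ω|)ν_ω+r) conj(û((n/|p_ω|)ν_ω+r))`, using
the parametrisation of `ω_m^⊥` by `{k ∈ ℤ^d : k·p_ω = m}`. -/
def kerKb (u : Zd d → ℂ) (h : ℝ) (ω : ResonantDir d) (b : Rd d → ℂ) (m n : ℤ) : ℂ :=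
  if ω.M ∣ (n - m) then
    ∑' k : {k : Zd d // dotZ k ω.p = m},
      b (h • projPerp ω k.1) * u k.1 * conj (u (k.1 + ((n - m) / ω.M) • ω.p))
  else 0

/-- The pairing `∫_{𝕋^d} m(x) |u(x)|² dx` of a position density with a test
function `m`. -/
def posDenPair (u : Zd d → ℂ) (m : Td d → ℂ) : ℂ :=
  (((2 * Real.pi) ^ d : ℝ) : ℂ)⁻¹ *
    ∑' q : Zd d × Zd d, u q.1 * conj (u q.2) * ∫ x : Td d, m x * char (q.1 - q.2) x

/-- Fourier coefficients of the `2πℤ^d`-periodisation of the wave packet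
`h^{-d/4} ρ((x-x₀)/√h) e^{iξ₀·x/h}` (for `ρ` supported in `(-π,π)^d`). -/
def wavePacket (ρ : Rd d → ℂ) (x₀ ξ₀ : Rd d) (h : ℝ) (k : Zd d) : ℂ :=
  ((Real.sqrt ((2 * Real.pi) ^ d) : ℝ) : ℂ)⁻¹ *
    ∫ x : Rd d, ((h ^ (-(d : ℝ) / 4) : ℝ) : ℂ) * ρ (fun i => (x i - x₀ i) / Real.sqrt h) *
      Complex.exp (Complex.I * ((∑ i, (ξ₀ i / h - (k i : ℝ)) * x i : ℝ) : ℂ))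

/-- Fourier coefficients of the `2πℤ^d`-periodisation of `ρ(x) e^{iξ₀·x/h}` (for
`ρ` supported in `(-π,π)^d`). -/
def oscData (ρ : Rd d → ℂ) (ξ₀ : Rd d) (h : ℝ) (k : Zd d) : ℂ :=
  ((Real.sqrt ((2 * Real.pi) ^ d) : ℝ) : ℂ)⁻¹ *
    ∫ x : Rd d, ρ x * Complex.exp (Complex.I * ((∑ i, (ξ₀ i / h - (k i : ℝ)) * x i : ℝ) : ℂ))

/-- The solution `e^{itΔ/2} ρ_per` on `𝕋^d`, where `ρ_per` is the
`2πℤ^d`-periodisation of `ρ`. -/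
def evolvedPer (ρ : Rd d → ℂ) (t : ℝ) (x : Td d) : ℂ :=
  ((Real.sqrt ((2 * Real.pi) ^ d) : ℝ) : ℂ)⁻¹ *
    ∑' k : Zd d,
      Complex.exp (-Complex.I * (t : ℂ) * ((∑ i, ((k i : ℝ)) ^ 2 : ℝ) : ℂ) / 2) *
        oscData ρ 0 1 k * char k x

/-- Euclidean norm on `ℝ^d`. -/
def euclNorm (ξ : Rd d) : ℝ := Real.sqrt (∑ i, ξ i ^ 2)

/-- The length `L` of the periodic geodesic of `𝕋^d` issued from `(x, ξ₀)`: the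
least `l > 0` such that `l·ξ₀/|ξ₀| ∈ 2πℤ^d`. -/
def geoLen (ξ₀ : Rd d) : ℝ :=
  sInf {l : ℝ | 0 < l ∧ ∃ k : Zd d, (l / euclNorm ξ₀) • ξ₀ = (2 * Real.pi) • toRd k}

/-- The average `⟨f⟩_{ξ₀}(x) = (|ξ₀|/L)∫_0^{L/|ξ₀|} f(x+sξ₀) ds` along the closed
geodesic in the direction `ξ₀`. -/
def geoAvg (f : Td d → ℝ) (ξ₀ : Rd d) (x : Td d) : ℝ :=
  euclNorm ξ₀ / geoLen ξ₀ *
    ∫ s in Set.Ioc (0 : ℝ) (geoLen ξ₀ / euclNorm ξ₀), f (x + torusProj (s • ξ₀))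

lemma ResonantDir.M_pos (ω : ResonantDir d) : 0 < ω.M := by
  obtain ⟨i, hi⟩ := Function.ne_iff.mp ω.ne
  exact Finset.sum_pos' (fun j _ => mul_self_nonneg _)
    ⟨i, Finset.mem_univ i, mul_self_pos.mpr hi⟩

/-- Bézout's identity for the primitive vector `p_ω`. -/
lemma ResonantDir.exists_dotZ_eq_one (ω : ResonantDir d) : ∃ c : Zd d, dotZ c ω.p = 1 := by
  obtain ⟨g, hg⟩ := IsPrincipalIdealRing.principal (Ideal.span (Set.range ω.p))
  have hdvd : ∀ i, g ∣ ω.p i := fun i => by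
    rw [← Ideal.mem_span_singleton, Ideal.span, ← hg]
    exact Ideal.subset_span (Set.mem_range_self i)
  have hunit : g.natAbs ∣ 1 := by
    rw [← ω.gcd_one]
    exact Finset.dvd_gcd fun i _ => Int.natAbs_dvd_natAbs.mpr (hdvd i)
  have htop : (1 : ℤ) ∈ Ideal.span (Set.range ω.p) := by
    rw [hg]
    refine Ideal.mem_span_singleton.mpr ?_
    exact (Int.isUnit_iff_natAbs_eq.mpr (Nat.dvd_one.mp hunit)).dvd
  exact Ideal.mem_span_range_iff_exists_fun.mp htop

lemma dotZ_add (k l q : Zd d) : dotZ (k + l) q = dotZ k q + dotZ l q := by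
  simp [dotZ, add_mul, Finset.sum_add_distrib]

lemma dotZ_smul (a : ℤ) (k q : Zd d) : dotZ (a • k) q = a * dotZ k q := by
  simp [dotZ, mul_assoc, Finset.mul_sum]

lemma dotR_toRd (k l : Zd d) : dotR k (toRd l) = (dotZ l k : ℝ) := by
  simp [dotR, dotZ, toRd, mul_comm]

lemma dotR_add (k : Zd d) (x y : Rd d) : dotR k (x + y) = dotR k x + dotR k y := by
  simp [dotR, mul_add, Finset.sum_add_distrib]

lemma dotR_sub (k : Zd d) (x y : Rd d) : dotR k (x - y) = dotR k x - dotR k y := by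
  simp [dotR, mul_sub, Finset.sum_sub_distrib]

lemma dotR_smul (k : Zd d) (a : ℝ) (x : Rd d) : dotR k (a • x) = a * dotR k x := by
  simp [dotR, Finset.mul_sum, mul_left_comm]

lemma ResonantDir.M_ne_zero (ω : ResonantDir d) : (ω.M : ℝ) ≠ 0 :=
  Int.cast_ne_zero.mpr ω.M_pos.ne'

lemma ResonantDir.div_mul_dotR_p (ω : ResonantDir d) (a : ℝ) :
    a / (ω.M : ℝ) * dotR ω.p (toRd ω.p) = a := by
  rw [dotR_toRd]
  exact div_mul_cancel₀ a ω.M_ne_zero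

/-- The set `ω_n^⊥` consists of the projections of the lattice points `k` with `k·p_ω = n`. -/
lemma mem_perpSet_iff (ω : ResonantDir d) (n : ℤ) (r : Rd d) :
    r ∈ perpSet ω n ↔ ∃ k : Zd d, dotZ k ω.p = n ∧ projPerp ω k = r := by
  constructor
  · rintro ⟨hr, k, hk⟩
    have hkn : dotZ k ω.p = n := by
      have h := congrArg (dotR ω.p) hk
      rw [dotR_add, dotR_smul, ω.div_mul_dotR_p, hr, add_zero, dotR_toRd] at h
      exact_mod_cast h
    exact ⟨k, hkn, by rw [projPerp, hkn, hk, add_sub_cancel_left]⟩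
  · rintro ⟨k, rfl, rfl⟩
    refine ⟨?_, k, by rw [projPerp, add_sub_cancel]⟩
    rw [projPerp, dotR_sub, dotR_smul, ω.div_mul_dotR_p, dotR_toRd, sub_self]

/-- The projection of the lattice onto `I_ω`, as a group homomorphism. -/
def projPerpHom (ω : ResonantDir d) : Zd d →+ Rd d :=
  AddMonoidHom.mk' (projPerp ω) fun k l => by
    ext i
    simp only [projPerp, toRd, dotZ_add, Pi.add_apply, Pi.sub_apply, Pi.smul_apply, smul_eq_mul]
    push_cast
    ring

lemma projPerp_add_smul_p (ω : ResonantDir d) (k : Zd d) (j : ℤ) :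
    projPerp ω (k + j • ω.p) = projPerp ω k := by
  have hM := ω.M_ne_zero
  have hp : dotZ ω.p ω.p = ω.M := rfl
  ext i
  simp only [projPerp, toRd, dotZ_add, dotZ_smul, hp, Pi.add_apply, Pi.sub_apply, Pi.smul_apply,
    smul_eq_mul]
  push_cast
  field_simp
  ring

lemma dvd_of_projPerp_eq (ω : ResonantDir d) {k l : Zd d} (h : projPerp ω k = projPerp ω l) :
    ω.M ∣ dotZ l ω.p - dotZ k ω.p := by
  obtain ⟨c, hc⟩ := ω.exists_dotZ_eq_one
  have hM := ω.M_ne_zero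
  have hcp : dotR c (toRd ω.p) = 1 := by
    rw [dotR_toRd, ← Int.cast_one, ← hc]
    simp [dotZ, mul_comm]
  have h' := congrArg (dotR c) h
  simp only [projPerp, dotR_sub, dotR_smul, hcp, dotR_toRd, mul_one] at h'
  field_simp at h'
  refine ⟨dotZ l c - dotZ k c, ?_⟩
  have : ((dotZ l ω.p - dotZ k ω.p : ℤ) : ℝ) = (ω.M * (dotZ l c - dotZ k c) : ℤ) := by
    push_cast
    linarith
  exact_mod_cast this

lemma perpSet_subset_of_dvd (ω : ResonantDir d) {m n : ℤ} (h : ω.M ∣ n - m) :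
    perpSet ω m ⊆ perpSet ω n := by
  obtain ⟨j, hj⟩ := h
  intro r hr
  obtain ⟨k, hk, rfl⟩ := (mem_perpSet_iff ω m r).mp hr
  refine (mem_perpSet_iff ω n _).mpr ⟨k + j • ω.p, ?_, projPerp_add_smul_p ω k j⟩
  have hp : dotZ ω.p ω.p = ω.M := rfl
  rw [dotZ_add, dotZ_smul, hk, hp]
  linarith

lemma perpSet_nonempty (ω : ResonantDir d) (n : ℤ) : (perpSet ω n).Nonempty := by
  obtain ⟨c, hc⟩ := ω.exists_dotZ_eq_one
  exact ⟨_, (mem_perpSet_iff ω n _).mpr ⟨n • c, by rw [dotZ_smul, hc, mul_one], rfl⟩⟩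

lemma iUnion_perpSet (ω : ResonantDir d) :
    ⋃ j : ℤ, perpSet ω j = Set.range (fun k : Zd d => projPerp ω k) := by
  ext r
  simp [mem_perpSet_iff]

lemma intCast_zmod_M_eq_iff (ω : ResonantDir d) (m n : ℤ) :
    (m : ZMod ω.M.toNat) = (n : ZMod ω.M.toNat) ↔ ω.M ∣ n - m := by
  rw [ZMod.intCast_eq_intCast_iff_dvd_sub, Int.toNat_of_nonneg ω.M_pos.le]

/-- `ω_m^⊥ ∩ ω_n^⊥ ≠ ∅` iff `m ≡ n (mod |p_ω|²)`, in which case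
`ω_m^⊥ = ω_n^⊥`; and `ω^⊥ = ⋃_n ω_n^⊥`, the set of orthogonal projections onto
`I_ω` of the vectors of `ℤ^d`, is a subgroup of `(ℝ^d, +)`. -/
theorem statement6 {d : ℕ} (ω : ResonantDir d) (m n : ℤ) :
    ((perpSet ω m ∩ perpSet ω n).Nonempty ↔ (m : ZMod ω.M.toNat) = (n : ZMod ω.M.toNat)) ∧
    ((m : ZMod ω.M.toNat) = (n : ZMod ω.M.toNat) → perpSet ω m = perpSet ω n) ∧
    (∃ G : AddSubgroup (Rd d), (G : Set (Rd d)) = ⋃ j : ℤ, perpSet ω j) ∧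
    (⋃ j : ℤ, perpSet ω j) = Set.range (fun k : Zd d => projPerp ω k) := by
  have heq : (m : ZMod ω.M.toNat) = (n : ZMod ω.M.toNat) → perpSet ω m = perpSet ω n := by
    intro h
    exact (perpSet_subset_of_dvd ω ((intCast_zmod_M_eq_iff ω m n).mp h)).antisymm
      (perpSet_subset_of_dvd ω ((intCast_zmod_M_eq_iff ω n m).mp h.symm))
  refine ⟨⟨?_, fun h => ?_⟩, heq, ⟨(projPerpHom ω).range, ?_⟩, iUnion_perpSet ω⟩
  · rintro ⟨r, hm, hn⟩
    obtain ⟨k, rfl, hk⟩ := (mem_perpSet_iff ω m r).mp hm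
    obtain ⟨l, rfl, hl⟩ := (mem_perpSet_iff ω n r).mp hn
    exact (intCast_zmod_M_eq_iff ω _ _).mpr (dvd_of_projPerp_eq ω (hk.trans hl.symm))
  · rw [heq h, Set.inter_self]
    exact perpSet_nonempty ω n
  · rw [iUnion_perpSet]
    rfl

end TorusSchrodinger
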